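/- Let Λ be a Nakayama algebra of finite global dimension. Then del Λ = findim Λ. -/

import Mathlib

open Function DirectSum
open scoped Classical

noncomputable section

section Preamble

variable (A : Type) [Ring A]

/-- A submodule is small (superfluous) if it has no proper supplement. -/
def IsSmallSubmodule {M : Type} [AddCommGroup M] [Module A M] (N : Submodule A M) : Prop :=
  ∀ K : Submodule A M, N ⊔ K = ⊤ → K = ⊤

/-- `P` is a projective cover of `M`: `P` is projective, finitely generated, and there is a
surjection `P → M` with small (superfluous) kernel. -/
def IsProjCoverOf (P M : ModuleCat.{0} A) : Prop :=
  Module.Projective A ↥P ∧ Module.Finite A ↥P ∧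
    ∃ f : ↥P →ₗ[A] ↥M, Function.Surjective f ∧ IsSmallSubmodule A (LinearMap.ker f)

/-- `N` is (isomorphic to) the syzygy `Ω(M)`, i.e. the kernel of a projective cover of `M`. -/
def IsSyzygyOf (N M : ModuleCat.{0} A) : Prop :=
  ∃ (P : ModuleCat.{0} A) (f : ↥P →ₗ[A] ↥M),
    Module.Projective A ↥P ∧ Module.Finite A ↥P ∧ Function.Surjective f ∧
      IsSmallSubmodule A (LinearMap.ker f) ∧ Nonempty (↥N ≃ₗ[A] ↥(LinearMap.ker f))

/-- `N` is (isomorphic to) the `n`-th syzygy `Ω^n(M)`. -/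
def IsNthSyzygyOf : ℕ → ModuleCat.{0} A → ModuleCat.{0} A → Prop
  | 0 => fun N M => Nonempty (↥N ≃ₗ[A] ↥M)
  | n + 1 => fun N M => ∃ K : ModuleCat.{0} A, IsNthSyzygyOf n K M ∧ IsSyzygyOf A N K

/-- An indecomposable module: nontrivial, with no nontrivial direct sum decomposition. -/
def IndecomposableModule (M : ModuleCat.{0} A) : Prop :=
  Nontrivial ↥M ∧ ∀ N N' : Submodule A ↥M, IsCompl N N' → N = ⊥ ∨ N = ⊤

/-- A uniserial module: the submodules form a chain. -/
def IsUniserialModule (M : ModuleCat.{0} A) : Prop :=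
  ∀ N N' : Submodule A ↥M, N ≤ N' ∨ N' ≤ N

/-- A (one-sided) Nakayama condition: an Artinian ring all of whose finitely generated
indecomposable modules are uniserial. -/
def IsNakayamaRing : Prop :=
  IsArtinianRing A ∧
    ∀ M : ModuleCat.{0} A, Module.Finite A ↥M → IndecomposableModule A M → IsUniserialModule A M

/-- A Nakayama algebra: all indecomposable finitely generated (left and right) modules
are uniserial. -/
def IsNakayamaAlgebra : Prop := IsNakayamaRing A ∧ IsNakayamaRing Aᵐᵒᵖ

/-- Connectedness: the only central idempotents are `0` and `1`. -/
def IsConnectedRing : Prop :=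
  ∀ e : A, IsIdempotentElem e → e ∈ Set.center A → e = 0 ∨ e = 1

/-- A cyclic Nakayama algebra: a connected Nakayama algebra whose quiver is a cyclically
oriented cycle, equivalently with no simple projective module. -/
def IsCyclicNakayama : Prop :=
  IsNakayamaAlgebra A ∧ IsConnectedRing A ∧
    ∀ M : ModuleCat.{0} A, IsSimpleModule A ↥M → ¬ Module.Projective A ↥M

/-- The projective dimension of a module, computed via minimal projective resolutions:
the least `n` such that `Ω^n(M)` is projective (`⊤ = ∞` if there is none). -/
def projDim (M : ModuleCat.{0} A) : ℕ∞ :=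
  sInf ((fun n : ℕ => (n : ℕ∞)) ''
    {n : ℕ | ∃ N : ModuleCat.{0} A, IsNthSyzygyOf A n N M ∧ Module.Projective A ↥N})

/-- The finitistic dimension: the supremum of the (finite) projective dimensions of
finitely generated modules of finite projective dimension. -/
def finDim : ℕ∞ :=
  sSup {d : ℕ∞ | d ≠ ⊤ ∧ ∃ M : ModuleCat.{0} A, Module.Finite A ↥M ∧ projDim A M = d}

/-- The global dimension: the supremum of the projective dimensions of all finitely
generated modules. -/
def globalDim : ℕ∞ :=
  sSup {d : ℕ∞ | ∃ M : ModuleCat.{0} A, Module.Finite A ↥M ∧ projDim A M = d}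

/-- `N` is a direct summand of `M`. -/
def IsDirectSummandOf (N M : ModuleCat.{0} A) : Prop :=
  ∃ C : ModuleCat.{0} A, Nonempty (↥M ≃ₗ[A] (↥N × ↥C))

/-- The delooping level of a module `M`:
`del M = min { d | Ω^d(M) is a direct summand of A ⊕ Ω^{d+1}(M') for some f.g. M' }`. -/
def delMod (M : ModuleCat.{0} A) : ℕ∞ :=
  sInf ((fun n : ℕ => (n : ℕ∞)) ''
    {d : ℕ | ∃ (M' N N' : ModuleCat.{0} A), Module.Finite A ↥M' ∧
      IsNthSyzygyOf A d N M ∧ IsNthSyzygyOf A (d + 1) N' M' ∧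
      IsDirectSummandOf A N (ModuleCat.of A (A × ↥N'))})

/-- The delooping level of the algebra: the supremum over simple modules. -/
def delAlg : ℕ∞ :=
  sSup {d : ℕ∞ | ∃ S : ModuleCat.{0} A, IsSimpleModule A ↥S ∧ delMod A S = d}

/-- A periodic module: `Ω^t(M) ≅ M` for some `t ≥ 1`. -/
def IsPeriodicModule (M : ModuleCat.{0} A) : Prop :=
  ∃ t : ℕ, 1 ≤ t ∧ IsNthSyzygyOf A t M M

/-- Selfinjectivity: the regular module is injective. -/
def IsSelfinjectiveRing : Prop := Module.Injective A A

/-- The socle of a module: the sum of all simple submodules. -/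
def socleOf (M : ModuleCat.{0} A) : Submodule A ↥M :=
  sSup {N : Submodule A ↥M | IsSimpleModule A ↥N}

/-- The radical of a module: `rad M = J(A)·M`. -/
def radOf (M : Type) [AddCommGroup M] [Module A M] : Submodule A M :=
  (Ideal.jacobson (⊥ : Ideal A)) • (⊤ : Submodule A M)

/-- The top of a module: `M / rad M`. -/
abbrev topOf (M : Type) [AddCommGroup M] [Module A M] :=
  M ⧸ radOf A M

end Preamble

section Phi

variable (A : Type) [Ring A]

/-- Finitely generated indecomposable modules. -/
def FGIndec := {M : ModuleCat.{0} A // Module.Finite A ↥M ∧ IndecomposableModule A M}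

/-- Isomorphism as a setoid on finitely generated indecomposable modules. -/
def indecSetoid : Setoid (FGIndec A) where
  r X Y := Nonempty (↥X.1 ≃ₗ[A] ↥Y.1)
  iseqv := ⟨fun _ => ⟨LinearEquiv.refl A _⟩,
            fun h => h.elim fun e => ⟨e.symm⟩,
            fun h h' => h.elim fun e => h'.elim fun e' => ⟨e.trans e'⟩⟩

/-- Isomorphism classes of finitely generated indecomposable modules. -/
abbrev IndecIso := Quotient (indecSetoid A)

/-- The free abelian group on iso-classes of f.g. indecomposable modules. -/
abbrev K0Group := IndecIso A →₀ ℤ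

/-- `f` records a decomposition of `M` as a direct sum of indecomposables with
multiplicities. -/
def IsDecompositionOf (f : IndecIso A →₀ ℕ) (M : ModuleCat.{0} A) : Prop :=
  Nonempty (↥M ≃ₗ[A] DirectSum (Σ x : f.support, Fin (f x.1))
    (fun i => ↥((Quotient.out i.1.1).1)))

/-- The class of `M` in the free abelian group on indecomposables (junk value `0` if no
decomposition exists). -/
def decompClass (M : ModuleCat.{0} A) : K0Group A :=
  if h : ∃ f : IndecIso A →₀ ℕ, IsDecompositionOf A f M
  then (Classical.choose h).mapRange (fun m : ℕ => (m : ℤ)) (by simp)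
  else 0

/-- A choice of syzygy module `Ω(M)` (junk value `0` if no projective cover exists). -/
def syzygyModule (M : ModuleCat.{0} A) : ModuleCat.{0} A :=
  if h : ∃ N : ModuleCat.{0} A, IsSyzygyOf A N M then Classical.choose h
  else ModuleCat.of A PUnit

/-- The Igusa–Todorov endomorphism `L` of the free abelian group on indecomposables,
sending `[M] ↦ [Ω M]`. -/
def syzygyEnd : AddMonoid.End (K0Group A) :=
  Finsupp.liftAddHom fun x : IndecIso A =>
    (zmultiplesHom (K0Group A)) (decompClass A (syzygyModule A (Quotient.out x).1))

/-- The generators `[X]`, `X` an indecomposable direct summand of `M`, of the subgroup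
`⟨add M⟩`. -/
def addGenerators (M : ModuleCat.{0} A) : Set (K0Group A) :=
  {g | ∃ (X : ModuleCat.{0} A) (h : Module.Finite A ↥X ∧ IndecomposableModule A X),
      IsDirectSummandOf A X M ∧ g = Finsupp.single (Quotient.mk (indecSetoid A) ⟨X, h⟩) 1}

/-- The Igusa–Todorov function `φ(M)`: the least `t` at which the rank of
`L^t⟨add M⟩` stabilizes. -/
def phiMod (M : ModuleCat.{0} A) : ℕ∞ :=
  sInf ((fun n : ℕ => (n : ℕ∞)) ''
    {t : ℕ | ∀ j : ℕ, 1 ≤ j →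
      Module.finrank ℤ
        ↥(AddSubgroup.map ((syzygyEnd A) ^ t) (AddSubgroup.closure (addGenerators A M))) =
      Module.finrank ℤ
        ↥(AddSubgroup.map ((syzygyEnd A) ^ (t + j)) (AddSubgroup.closure (addGenerators A M)))})

/-- The `φ`-dimension of the algebra. -/
def phiDim : ℕ∞ :=
  sSup {d : ℕ∞ | ∃ M : ModuleCat.{0} A, Module.Finite A ↥M ∧ phiMod A M = d}

end Phi

section Epsilon

variable (A : Type) [Ring A]

/-- `T` is (isomorphic to) the socle of some indecomposable projective module. -/
def IsSocleOfIndecProjective (T : ModuleCat.{0} A) : Prop :=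
  IsSimpleModule A ↥T ∧ ∃ Q : ModuleCat.{0} A, Module.Projective A ↥Q ∧ Module.Finite A ↥Q ∧
    IndecomposableModule A Q ∧ Nonempty (↥T ≃ₗ[A] ↥(socleOf A Q))

/-- `S` belongs to `S'(Λ)`: `S ≅ S_{i+1}` where `S_i` is a socle of an indecomposable
projective; here `S_{i+1} = top (rad P(S_i))` for the cyclic quiver. -/
def IsInSPrime (S : ModuleCat.{0} A) : Prop :=
  IsSimpleModule A ↥S ∧ ∃ T P : ModuleCat.{0} A, IsSocleOfIndecProjective A T ∧
    IsProjCoverOf A P T ∧ Nonempty ((topOf A ↥(radOf A ↥P)) ≃ₗ[A] ↥S)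

/-- `B` is (isomorphic to) the syzygy filtered algebra
`ε(Λ) = End_Λ(⊕_{S ∈ S'(Λ)} P(S))`. -/
def IsSyzygyFilteredAlgebra (B : Type) [Ring B] : Prop :=
  ∃ (ι : Type) (_ : Fintype ι) (Sf Pf : ι → ModuleCat.{0} A),
    (∀ i, IsInSPrime A (Sf i) ∧ IsProjCoverOf A (Pf i) (Sf i)) ∧
    (∀ i j, Nonempty (↥(Sf i) ≃ₗ[A] ↥(Sf j)) → i = j) ∧
    (∀ S : ModuleCat.{0} A, IsInSPrime A S → ∃ i, Nonempty (↥S ≃ₗ[A] ↥(Sf i))) ∧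
    Nonempty (B ≃+* Module.End A (DirectSum ι fun i => ↥(Pf i)))

/-- `B` is (isomorphic to) the `d`-th iterated syzygy filtered algebra `ε^d(Λ)`,
each intermediate step being a cyclic non-selfinjective Nakayama algebra. -/
def IsIterSyzygyFiltered (d : ℕ) (B : Type) [Ring B] : Prop :=
  ∃ C : ℕ → RingCat.{0},
    Nonempty (A ≃+* ↥(C 0)) ∧ Nonempty (↥(C d) ≃+* B) ∧
    ∀ i < d, IsCyclicNakayama ↥(C i) ∧ ¬ IsSelfinjectiveRing ↥(C i) ∧
      IsSyzygyFilteredAlgebra ↥(C i) ↥(C (i + 1))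

end Epsilon


section ProjectiveDimension

open CategoryTheory

variable {A : Type} [Ring A]

theorem IsSyzygyOf.hasProjectiveDimensionLT_iff {N M : ModuleCat.{0} A} (h : IsSyzygyOf A N M)
    (m : ℕ) : HasProjectiveDimensionLT M (m + 2) ↔ HasProjectiveDimensionLT N (m + 1) := by
  obtain ⟨P, f, hP, -, hf, -, ⟨e⟩⟩ := h
  have hse := LinearMap.shortExact_shortComplexKer hf
  have key := hse.hasProjectiveDimensionLT_X₃_iff m
    (ModuleCat.projective_of_categoryTheory_projective P)
  refine key.trans ⟨fun h => ?_, fun h => ?_⟩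
  · exact hasProjectiveDimensionLT_of_iso
      (show ModuleCat.of A (LinearMap.ker f) ≅ N from e.symm.toModuleIso) _
  · exact hasProjectiveDimensionLT_of_iso
      (show N ≅ ModuleCat.of A (LinearMap.ker f) from e.toModuleIso) _

theorem IsNthSyzygyOf.hasProjectiveDimensionLT_iff {n : ℕ} {N M : ModuleCat.{0} A}
    (h : IsNthSyzygyOf A n N M) (m : ℕ) :
    HasProjectiveDimensionLT M (n + m + 1) ↔ HasProjectiveDimensionLT N (m + 1) := by
  induction n generalizing N m with
  | zero =>
    obtain ⟨e⟩ := h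
    rw [Nat.zero_add]
    exact ⟨fun _ => hasProjectiveDimensionLT_of_iso e.symm.toModuleIso _,
      fun _ => hasProjectiveDimensionLT_of_iso e.toModuleIso _⟩
  | succ n ih =>
    obtain ⟨K, hK, hN⟩ := h
    rw [← hN.hasProjectiveDimensionLT_iff m, ← ih hK (m + 1)]
    congr! 1
    omega

theorem IsNthSyzygyOf.projective_iff {n : ℕ} {N M : ModuleCat.{0} A}
    (h : IsNthSyzygyOf A n N M) :
    Module.Projective A N ↔ HasProjectiveDimensionLT M (n + 1) := by
  rw [← Nat.add_zero n, h.hasProjectiveDimensionLT_iff 0, Nat.zero_add,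
    ← projective_iff_hasProjectiveDimensionLT_one]
  exact IsProjective.iff_projective N

/-- A finite projective dimension is realised by a projective syzygy. -/
theorem exists_projective_isNthSyzygyOf {M : ModuleCat.{0} A} (h : projDim A M ≠ ⊤) :
    ∃ (n : ℕ) (N : ModuleCat.{0} A), projDim A M = n ∧ IsNthSyzygyOf A n N M ∧
      Module.Projective A N := by
  have hne : ((fun n : ℕ => (n : ℕ∞)) ''
      {n : ℕ | ∃ N : ModuleCat.{0} A, IsNthSyzygyOf A n N M ∧ Module.Projective A ↥N}).Nonempty := by
    by_contra hemp
    rw [Set.not_nonempty_iff_eq_empty] at hemp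
    rw [projDim, hemp, sInf_empty] at h
    exact h rfl
  obtain ⟨n, ⟨N, hN⟩, hn⟩ := csInf_mem hne
  exact ⟨n, N, hn.symm, hN⟩

theorem hasProjectiveDimensionLT_of_projDim_le {M : ModuleCat.{0} A} {n : ℕ}
    (h : projDim A M ≤ n) : HasProjectiveDimensionLT M (n + 1) := by
  obtain ⟨k, N, hk, hN, hproj⟩ :=
    exists_projective_isNthSyzygyOf (ne_top_of_le_ne_top (ENat.natCast_ne_top n) h)
  have hkn : k ≤ n := by
    rw [hk] at h
    exact_mod_cast h
  have := hN.projective_iff.1 hproj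
  exact hasProjectiveDimensionLT_of_ge M (k + 1) (n + 1) (by omega)

theorem IsNthSyzygyOf.projDim_le {n : ℕ} {N M : ModuleCat.{0} A}
    (h : IsNthSyzygyOf A n N M) (hM : HasProjectiveDimensionLT M (n + 1)) :
    projDim A M ≤ n :=
  sInf_le ⟨n, ⟨N, h, h.projective_iff.2 hM⟩, rfl⟩

/-- If every simple module has projective dimension `< n`, so does every module of finite
length. -/
theorem IsFiniteLength.hasProjectiveDimensionLT {n : ℕ}
    (hn : ∀ S : ModuleCat.{0} A, IsSimpleModule A S → HasProjectiveDimensionLT S n)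
    {M : Type} [AddCommGroup M] [Module A M] (h : IsFiniteLength A M) :
    HasProjectiveDimensionLT (ModuleCat.of A M) n := by
  induction h with
  | @of_subsingleton M _ _ _ =>
    have := (ModuleCat.isZero_of_subsingleton (ModuleCat.of A M)).hasProjectiveDimensionLT_zero
    exact hasProjectiveDimensionLT_of_ge _ 0 n (Nat.zero_le n)
  | @of_simple_quotient M _ _ N hS _ ih =>
    have hse := LinearMap.shortExact_shortComplexKer (Submodule.mkQ_surjective N)
    refine hse.hasProjectiveDimensionLT_X₂ n ?_ (hn (ModuleCat.of A (M ⧸ N)) hS)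
    exact hasProjectiveDimensionLT_of_iso
      (show ModuleCat.of A N ≅ ModuleCat.of A (LinearMap.ker N.mkQ) from
        (LinearEquiv.ofEq _ _ (Submodule.ker_mkQ N).symm).toModuleIso) _

theorem HasProjectiveDimensionLT.prod {X Y : ModuleCat.{0} A} {n : ℕ}
    (hX : HasProjectiveDimensionLT X n) (hY : HasProjectiveDimensionLT Y n) :
    HasProjectiveDimensionLT (ModuleCat.of A (X × Y)) n :=
  hasProjectiveDimensionLT_of_iso (ModuleCat.biprodIsoProd X Y) n

theorem IsDirectSummandOf.hasProjectiveDimensionLT {N M : ModuleCat.{0} A}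
    (h : IsDirectSummandOf A N M) {n : ℕ} (hM : HasProjectiveDimensionLT M n) :
    HasProjectiveDimensionLT N n := by
  obtain ⟨C, ⟨e⟩⟩ := h
  refine Retract.hasProjectiveDimensionLT (Y := M)
    { i := ModuleCat.ofHom (e.symm.toLinearMap ∘ₗ LinearMap.inl A N C)
      r := ModuleCat.ofHom (LinearMap.fst A N C ∘ₗ e.toLinearMap)
      retract := ?_ } n
  ext x
  simp

end ProjectiveDimension

section Syzygies

variable {A : Type} [Ring A]

theorem IsSyzygyOf.congr {N K M : ModuleCat.{0} A} (h : IsSyzygyOf A N K) (e : K ≃ₗ[A] M) :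
    IsSyzygyOf A N M := by
  obtain ⟨P, f, hP, hPfin, hf, hsmall, ⟨e'⟩⟩ := h
  have hker : LinearMap.ker (e.toLinearMap ∘ₗ f) = LinearMap.ker f := LinearEquiv.ker_comp e f
  exact ⟨P, e.toLinearMap ∘ₗ f, hP, hPfin, e.surjective.comp hf, hker ▸ hsmall,
    ⟨e'.trans (LinearEquiv.ofEq _ _ hker.symm)⟩⟩

theorem IsNthSyzygyOf.exists_isSyzygyOf {n : ℕ} {N M : ModuleCat.{0} A}
    (h : IsNthSyzygyOf A (n + 1) N M) : ∃ K : ModuleCat.{0} A, IsSyzygyOf A K M := by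
  induction n generalizing N with
  | zero =>
    obtain ⟨K, ⟨e⟩, hN⟩ := h
    exact ⟨N, hN.congr e⟩
  | succ n ih => exact ih h.choose_spec.1

theorem exists_isSyzygyOf_of_projective (M : ModuleCat.{0} A) [Module.Finite A M]
    [hM : Module.Projective A M] : ∃ N : ModuleCat.{0} A, IsSyzygyOf A N M := by
  refine ⟨ModuleCat.of A (LinearMap.ker (LinearMap.id : M →ₗ[A] M)), M, LinearMap.id, hM,
    inferInstance, Function.surjective_id, fun K hK => ?_, ⟨LinearEquiv.refl A _⟩⟩
  simpa using hK

/-- A finitely generated module of finite projective dimension has a syzygy. -/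
theorem exists_isSyzygyOf {M : ModuleCat.{0} A} [Module.Finite A M] (h : projDim A M ≠ ⊤) :
    ∃ N : ModuleCat.{0} A, IsSyzygyOf A N M := by
  obtain ⟨n, N, -, hN, hproj⟩ := exists_projective_isNthSyzygyOf h
  cases n with
  | zero =>
    have : Module.Projective A M := Module.Projective.of_equiv hN.some
    exact exists_isSyzygyOf_of_projective M
  | succ n => exact hN.exists_isSyzygyOf

theorem IsSyzygyOf.finite [IsNoetherianRing A] {N M : ModuleCat.{0} A} (h : IsSyzygyOf A N M) :
    Module.Finite A N := by
  obtain ⟨P, f, -, _, -, -, ⟨e⟩⟩ := h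
  exact Module.Finite.equiv e.symm

theorem IsNthSyzygyOf.finite [IsNoetherianRing A] {n : ℕ} {N M : ModuleCat.{0} A}
    [Module.Finite A M] (h : IsNthSyzygyOf A n N M) : Module.Finite A N := by
  cases n with
  | zero => exact Module.Finite.equiv h.some.symm
  | succ n => exact h.choose_spec.2.finite

theorem exists_isNthSyzygyOf [IsNoetherianRing A]
    (h : ∀ M : ModuleCat.{0} A, Module.Finite A M → projDim A M ≠ ⊤)
    (n : ℕ) (M : ModuleCat.{0} A) [Module.Finite A M] :
    ∃ N : ModuleCat.{0} A, IsNthSyzygyOf A n N M := by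
  induction n with
  | zero => exact ⟨M, ⟨LinearEquiv.refl A M⟩⟩
  | succ n ih =>
    obtain ⟨K, hK⟩ := ih
    have := hK.finite
    obtain ⟨N, hN⟩ := exists_isSyzygyOf (h K this)
    exact ⟨N, K, hK, hN⟩

end Syzygies

section Uniserial

variable {A : Type} [Ring A]

theorem IsUniserialModule.of_injective {M N : ModuleCat.{0} A} (hM : IsUniserialModule A M)
    (f : N →ₗ[A] M) (hf : Function.Injective f) : IsUniserialModule A N := fun X Y => by
  rw [← Submodule.map_le_map_iff_of_injective hf X Y,
    ← Submodule.map_le_map_iff_of_injective hf Y X]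
  exact hM _ _

theorem isUniserialModule_of_isSimpleModule {S : ModuleCat.{0} A} (hS : IsSimpleModule A S) :
    IsUniserialModule A S := fun X Y => by
  rcases eq_bot_or_eq_top X with rfl | rfl
  · exact .inl bot_le
  · exact .inr le_top

/-- Over a Nakayama ring, syzygies of uniserial modules are uniserial. -/
theorem IsSyzygyOf.isUniserialModule (hA : IsNakayamaRing A) {N M : ModuleCat.{0} A}
    (h : IsSyzygyOf A N M) (hM : IsUniserialModule A M) : IsUniserialModule A N := by
  obtain ⟨P, f, -, hPfin, hf, hsmall, ⟨e⟩⟩ := h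
  have eq_top {X : Submodule A P} (hX : X.map f = ⊤) : X = ⊤ := hsmall X (by
    rw [sup_comm, ← Submodule.comap_map_eq, hX, Submodule.comap_top])
  have hP : IsUniserialModule A P := by
    rcases subsingleton_or_nontrivial P with hP | hP
    · exact fun X Y => .inl (Subsingleton.elim X Y).le
    · refine hA.2 P hPfin ⟨hP, fun X Y hXY => ?_⟩
      have hsup : X.map f ⊔ Y.map f = ⊤ := by
        rw [← Submodule.map_sup, hXY.sup_eq_top, Submodule.map_top,
          LinearMap.range_eq_top.2 hf]
      rcases hM (X.map f) (Y.map f) with hle | hle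
      · rw [sup_eq_right.2 hle] at hsup
        exact .inl (eq_bot_of_isCompl_top (eq_top hsup ▸ hXY))
      · rw [sup_eq_left.2 hle] at hsup
        exact .inr (eq_top hsup)
  exact hP.of_injective ((LinearMap.ker f).subtype ∘ₗ e.toLinearMap)
    ((Submodule.injective_subtype _).comp e.injective)

theorem IsNthSyzygyOf.isUniserialModule (hA : IsNakayamaRing A) {n : ℕ} {N M : ModuleCat.{0} A}
    (h : IsNthSyzygyOf A n N M) (hM : IsUniserialModule A M) : IsUniserialModule A N := by
  induction n generalizing N with
  | zero => exact hM.of_injective h.some.toLinearMap h.some.injective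
  | succ n ih => exact h.choose_spec.2.isUniserialModule hA (ih h.choose_spec.1)

theorem IsUniserialModule.exists_span_singleton_eq_top {M : ModuleCat.{0} A}
    [Module.Finite A M] (hM : IsUniserialModule A M) : ∃ x : M, Submodule.span A {x} = ⊤ := by
  rcases eq_top_or_exists_le_coatom (⊥ : Submodule A M) with h | ⟨K, hK, -⟩
  · exact ⟨0, by rw [Submodule.span_zero_singleton, h]⟩
  · obtain ⟨x, -, hx⟩ := SetLike.exists_of_lt hK.lt_top
    refine ⟨x, hK.2 _ (lt_of_le_of_ne ?_ ?_)⟩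
    · exact (hM K _).resolve_right fun h => hx (h (Submodule.mem_span_singleton_self x))
    · exact fun h => hx (h ▸ Submodule.mem_span_singleton_self x)

theorem IsUniserialModule.isDirectSummandOf_of_projective {N : ModuleCat.{0} A}
    [Module.Finite A N] [Module.Projective A N] (hN : IsUniserialModule A N)
    (X : ModuleCat.{0} A) : IsDirectSummandOf A N (ModuleCat.of A (A × X)) := by
  obtain ⟨x, hx⟩ := hN.exists_span_singleton_eq_top
  let f : A × X →ₗ[A] N := LinearMap.toSpanSingleton A N x ∘ₗ LinearMap.fst A A X
  have hf : Function.Surjective f := by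
    rw [LinearMap.coe_comp]
    refine Function.Surjective.comp ?_ LinearMap.fst_surjective
    rw [← LinearMap.range_eq_top, LinearMap.range_toSpanSingleton, hx]
  obtain ⟨s, hs⟩ := Module.projective_lifting_property f LinearMap.id hf
  let e := (LinearMap.exact_subtype_ker_map f).splitSurjectiveEquiv
    (Submodule.injective_subtype _) ⟨s, hs⟩
  exact ⟨ModuleCat.of A (LinearMap.ker f), ⟨e.1.trans (LinearEquiv.prodComm A _ _)⟩⟩

end Uniserial

section DeloopingLevel

open CategoryTheory

variable {A : Type} [Ring A]

/-- Over a Nakayama ring of finite global dimension, the delooping level of a simple module is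
at most its projective dimension. -/
theorem delMod_le_projDim (hA : IsNakayamaRing A)
    (h : ∀ M : ModuleCat.{0} A, Module.Finite A M → projDim A M ≠ ⊤)
    {S : ModuleCat.{0} A} (hS : IsSimpleModule A S) : delMod A S ≤ projDim A S := by
  have := hA.1
  obtain ⟨n, N, hn, hN, _⟩ := exists_projective_isNthSyzygyOf (h S inferInstance)
  obtain ⟨N', hN'⟩ := exists_isNthSyzygyOf h (n + 1) S
  have := hN.finite
  rw [hn]
  exact sInf_le ⟨n, ⟨S, N, N', inferInstance, hN, hN',
    (hN.isUniserialModule hA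
      (isUniserialModule_of_isSimpleModule hS)).isDirectSummandOf_of_projective N'⟩, rfl⟩

/-- If all finitely generated modules have projective dimension at most `n`, then a module whose
projective dimension is not smaller than `n` has delooping level at least `n`. -/
theorem le_delMod {n : ℕ}
    (h : ∀ M : ModuleCat.{0} A, Module.Finite A M → HasProjectiveDimensionLT M (n + 1))
    {S : ModuleCat.{0} A} (hS : ¬ HasProjectiveDimensionLT S n) : (n : ℕ∞) ≤ delMod A S := by
  refine le_sInf ?_
  rintro _ ⟨d, ⟨M', N, N', hM', hN, hN', hsum⟩, rfl⟩
  by_contra! hlt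
  replace hlt : d < n := by exact_mod_cast hlt
  obtain ⟨m, rfl⟩ : ∃ m, n = d + m + 1 := ⟨n - d - 1, by omega⟩
  refine hS ((hN.hasProjectiveDimensionLT_iff m).2 (hsum.hasProjectiveDimensionLT ?_))
  have hN'' : HasProjectiveDimensionLT N' (m + 1) :=
    (hN'.hasProjectiveDimensionLT_iff m).1 (by convert h M' hM' using 1; omega)
  have : HasProjectiveDimensionLT (ModuleCat.of A A) (m + 1) := inferInstance
  exact HasProjectiveDimensionLT.prod this hN''

end DeloopingLevel

/-- For a Nakayama algebra of finite global dimension,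
`del Λ = findim Λ`. -/
theorem del_eq_findim_of_finite_globalDim
    (A : Type) [Ring A] (hA : IsNakayamaAlgebra A) (hgl : globalDim A ≠ ⊤) :
    delAlg A = finDim A := by
  have := hA.1.1
  have hfin (M : ModuleCat.{0} A) (hM : Module.Finite A M) : projDim A M ≠ ⊤ :=
    ne_top_of_le_ne_top hgl (le_sSup ⟨M, hM, rfl⟩)
  have hfindim : finDim A = globalDim A := by
    refine congrArg sSup (Set.ext fun d => ⟨fun h => h.2, ?_⟩)
    rintro ⟨M, hM, rfl⟩
    exact ⟨hfin M hM, M, hM, rfl⟩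
  rw [hfindim]
  apply le_antisymm
  · refine sSup_le ?_
    rintro _ ⟨S, hS, rfl⟩
    exact (delMod_le_projDim hA.1 hfin hS).trans (le_sSup ⟨S, inferInstance, rfl⟩)
  obtain ⟨n, hn⟩ := ENat.ne_top_iff_exists.1 hgl
  have hle (M : ModuleCat.{0} A) (hM : Module.Finite A M) :
      CategoryTheory.HasProjectiveDimensionLT M (n + 1) :=
    hasProjectiveDimensionLT_of_projDim_le (hn ▸ le_sSup ⟨M, hM, rfl⟩)
  rw [← hn]
  cases n with
  | zero => simp
  | succ n =>
    obtain ⟨S, hS, hSn⟩ : ∃ S : ModuleCat.{0} A, IsSimpleModule A S ∧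
        ¬ CategoryTheory.HasProjectiveDimensionLT S (n + 1) := by
      by_contra! hsimple
      have hgln : globalDim A ≤ n := by
        refine sSup_le ?_
        rintro _ ⟨M, hM, rfl⟩
        obtain ⟨N, hN⟩ := exists_isNthSyzygyOf hfin n M
        exact hN.projDim_le (IsFiniteLength.hasProjectiveDimensionLT hsimple
          (isFiniteLength_iff_isNoetherian_isArtinian.2 ⟨inferInstance, inferInstance⟩))
      rw [← hn] at hgln
      have : n + 1 ≤ n := by exact_mod_cast hgln
      omega
    exact (le_delMod hle hSn).trans (le_sSup ⟨S, hS, rfl⟩)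

end
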